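/- arXiv:2508.11219 — 2 statements merged into one kernel-verified Lean document; each statement's English description precedes it below -/
import Mathlib

section
/- Let A ∈ ℂ^{m×N}, y ∈ ℂ^m, h(x) = (1/2)‖Ax − y‖², and let f : ℂ^N → ℝ be L-smooth with F = h + f and F* ∈ ℝ satisfying F(x) ≥ F* for all x. Fix 0 < η̲ ≤ η̄ < ∞ and 0 < α < 2η̲/(η̲ + L), and let (B_k)_{k≥1} be Hermitian matrices with η̲ I_N ⪯ B_k ⪯ η̄ I_N. Let (x_k)_{k≥1} ⊂ ℂ^N be such that for each k, the function Φ_k(x) = h(x) + Re⟨∇f(x_k), x⟩ + (1/(2α))(x − x_k)^H B_k (x − x_k) is η̲-strongly convex and x_{k+1} is its global minimizer over ℂ^N. Fix t ∈ (0, 1/2] and c > 0, and assume the Kurdyka–Łojasiewicz bound (F(x_{k+1}) − F*)^{2t} ≤ c²(1−t)² ‖∇h(x_{k+1}) + ∇f(x_{k+1})‖² holds for all k ≥ 1, and that F(x_k) > F* for all k ≥ 1. Then, with υ = η̲/α − (η̲+L)/2, γ = c²(1−t)²(Lα + η̄)²/(υ α²), and F₁ = F(x₁) − F*, one has for all k ≥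 1: F(x_{k+1}) − F* ≤ (1 − F₁^{2t−1}/(F₁^{2t−1} + γ))^k · F₁. -/
open Matrix
open scoped ComplexOrder

theorem descent_aux {E : Type*} [NormedAddCommGroup E] [InnerProductSpace ℝ E] [CompleteSpace E]
    (f : E → ℝ) (L : ℝ) (hf : Differentiable ℝ f)
    (hl : ∀ a b, ‖gradient f a - gradient f b‖ ≤ L * ‖a - b‖) (a d : E) :
    f (a + d) ≤ f a + inner ℝ (gradient f a) d + L / 2 * ‖d‖ ^ 2 := by
  have hd : ∀ s : ℝ, HasDerivAt (fun s : ℝ => f (a + s • d) - s * inner ℝ (gradient f a) d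
      - L / 2 * s ^ 2 * ‖d‖ ^ 2)
      (inner ℝ (gradient f (a + s • d)) d - inner ℝ (gradient f a) d - L * s * ‖d‖ ^ 2) s := by
    intro s
    have h1 : HasDerivAt (fun s : ℝ => a + s • d) d s := by
      simpa using ((hasDerivAt_id s).smul_const d).const_add a
    have h2 := ((hf (a + s • d)).hasGradientAt.hasFDerivAt).comp_hasDerivAt s h1
    have h3 := (hasDerivAt_id s).mul_const (inner ℝ (gradient f a) d)
    have h4 := (((hasDerivAt_id s).pow 2).const_mul (L/2)).mul_const (‖d‖ ^ 2)
    have h5 := (h2.sub h3).sub h4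
    refine h5.congr_deriv ?_
    simp only [InnerProductSpace.toDual_apply_apply, id, pow_one, Nat.cast_ofNat, one_mul, mul_one, Nat.add_one_sub_one]
    ring
  have hanti : AntitoneOn (fun s : ℝ => f (a + s • d) - s * inner ℝ (gradient f a) d
      - L / 2 * s ^ 2 * ‖d‖ ^ 2) (Set.Icc 0 1) := by
    apply antitoneOn_of_deriv_nonpos (convex_Icc 0 1)
    · exact fun s _ => (hd s).continuousAt.continuousWithinAt
    · exact fun s _ => (hd s).differentiableAt.differentiableWithinAt
    · intro s hs
      rw [interior_Icc] at hs
      rw [(hd s).deriv, ← inner_sub_left]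
      have h1 := real_inner_le_norm (gradient f (a + s • d) - gradient f a) d
      have h2 := hl (a + s • d) a
      rw [add_sub_cancel_left, norm_smul, Real.norm_of_nonneg hs.1.le] at h2
      nlinarith [norm_nonneg d]
  have := hanti (Set.left_mem_Icc.2 zero_le_one) (Set.right_mem_Icc.2 zero_le_one) zero_le_one
  simp only [zero_smul, one_smul, add_zero, zero_mul, one_mul, one_pow, mul_one, sub_zero, ne_eq,
    OfNat.ofNat_ne_zero, not_false_eq_true, zero_pow, mul_zero] at this
  linarith

theorem step_aux {E E' : Type*} [NormedAddCommGroup E] [InnerProductSpace ℝ E] [CompleteSpace E]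
    [NormedAddCommGroup E'] [InnerProductSpace ℝ E'] [CompleteSpace E']
    (T : E →L[ℝ] E') (S : E →L[ℝ] E) (hS : ∀ u v, inner ℝ (S u) v = inner ℝ u (S v))
    (y : E') (h : E → ℝ) (hh : ∀ z, h z = 1 / 2 * ‖T z - y‖ ^ 2) (g a b : E) (β : ℝ)
    (hmin : ∀ z, h b + inner ℝ g b + β / 2 * inner ℝ (b - a) (S (b - a)) ≤
       h z + inner ℝ g z + β / 2 * inner ℝ (z - a) (S (z - a))) :
    gradient h b = - (g + β • S (b - a)) ∧
    h a + inner ℝ g a = h b + inner ℝ g b + β * inner ℝ (b - a) (S (b - a))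
      + 1 / 2 * ‖T (b - a)‖ ^ 2 := by
  have hG : HasGradientAt h (ContinuousLinearMap.adjoint T (T b - y)) b := by
    rw [hasGradientAt_iff_hasFDerivAt]
    have h1 : HasFDerivAt (fun z => T z - y) T b := T.hasFDerivAt.sub_const y
    have h2 := h1.norm_sq.const_mul (1 / 2 : ℝ)
    have : h = fun z => 1 / 2 * ‖T z - y‖ ^ 2 := funext hh
    rw [this]
    refine h2.congr_fderiv ?_
    ext w
    simp only [InnerProductSpace.toDual_apply_apply, ContinuousLinearMap.adjoint_inner_left,
      ContinuousLinearMap.smul_apply, ContinuousLinearMap.comp_apply, innerSL_apply_apply, smul_eq_mul, nsmul_eq_mul]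
    push_cast
    ring
  have hQ : HasFDerivAt (fun z => h z + inner ℝ g z + β / 2 * inner ℝ (z - a) (S (z - a)))
      (InnerProductSpace.toDual ℝ E (ContinuousLinearMap.adjoint T (T b - y) + g + β • S (b - a)))
      b := by
    have h1 : HasFDerivAt (fun z => z - a) (ContinuousLinearMap.id ℝ E) b :=
      (hasFDerivAt_id b).sub_const a
    have h2 : HasFDerivAt (fun z => S (z - a)) S b := by
      exact S.hasFDerivAt.comp b h1
    have h3 := (h1.inner ℝ h2).const_mul (β / 2)
    have h4 := (hG.hasFDerivAt.add (innerSL ℝ g).hasFDerivAt).add h3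
    refine h4.congr_fderiv ?_
    ext w
    simp only [InnerProductSpace.toDual_apply_apply, inner_add_left, inner_smul_left,
      ContinuousLinearMap.add_apply, ContinuousLinearMap.smul_apply, ContinuousLinearMap.comp_apply,
      innerSL_apply_apply, smul_eq_mul, fderivInnerCLM_apply, ContinuousLinearMap.prod_apply,
      ContinuousLinearMap.id_apply, conj_trivial]
    rw [real_inner_comm (S (b - a)) w, hS]
    ring
  have hz : IsLocalMin (fun z => h z + inner ℝ g z + β / 2 * inner ℝ (z - a) (S (z - a))) b :=
    Filter.Eventually.of_forall hmin
  have hz := hz.hasFDerivAt_eq_zero hQ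
  have hz : ContinuousLinearMap.adjoint T (T b - y) + g + β • S (b - a) = 0 := by
    exact (InnerProductSpace.toDual ℝ E).map_eq_zero_iff.mp hz
  have hg : ContinuousLinearMap.adjoint T (T b - y) = - (g + β • S (b - a)) := by
    rw [add_assoc] at hz; exact eq_neg_of_add_eq_zero_left hz
  refine ⟨hG.gradient.trans hg, ?_⟩
  have e1 : T a - y = (T b - y) - T (b - a) := by simp
  have e2 : inner ℝ (T b - y) (T (b - a)) = - (inner ℝ g (b - a) + β * inner ℝ (b - a) (S (b - a))) := by
    rw [← ContinuousLinearMap.adjoint_inner_left, hg, inner_neg_left, inner_add_left,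
      inner_smul_left, hS]; simp
  rw [inner_sub_right] at e2
  rw [hh a, hh b, e1, norm_sub_sq_real, e2]
  ring

theorem norm_aux {E : Type*} [NormedAddCommGroup E] [InnerProductSpace ℝ E]
    (S : E →L[ℝ] E) (hS : ∀ u v, inner ℝ (S u) v = inner ℝ u (S v)) (H : ℝ) (hH : 0 < H)
    (h0 : ∀ u, 0 ≤ inner ℝ u (S u)) (h1 : ∀ u, inner ℝ u (S u) ≤ H * ‖u‖ ^ 2) (d : E) :
    ‖S d‖ ≤ H * ‖d‖ := by
  have k := h0 (H • d - S d)
  have e : inner ℝ (H • d - S d) (S (H • d - S d)) = H ^ 2 * inner ℝ d (S d) - 2 * H * ‖S d‖ ^ 2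
      + inner ℝ (S d) (S (S d)) := by
    simp only [map_sub, map_smul, inner_sub_left, inner_sub_right, inner_smul_left,
      inner_smul_right, conj_trivial]
    rw [← hS d (S d), real_inner_self_eq_norm_sq]
    ring
  rw [e] at k
  have k2 := h1 (S d)
  have k3 := h1 d
  have k4 : ‖S d‖ ^ 2 ≤ (H * ‖d‖) ^ 2 := by
    have : H * ‖S d‖ ^ 2 ≤ H * (H * ‖d‖) ^ 2 := by nlinarith [sq_nonneg H, mul_le_mul_of_nonneg_left k3 (sq_nonneg H)]
    exact le_of_mul_le_mul_left this hH
  exact le_of_sq_le_sq k4 (by positivity) 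

theorem rec_aux (G : ℕ → ℝ) (γ t : ℝ) (hγ : 0 ≤ γ) (ht : t ≤ 1 / 2) (hG : ∀ k, 1 ≤ k → 0 < G k)
    (hdec : ∀ k, 1 ≤ k → G (k + 1) ≤ G k)
    (hr : ∀ k, 1 ≤ k → G (k + 1) ^ (2 * t) ≤ γ * (G k - G (k + 1))) (k : ℕ) :
    G (k + 1) ≤ (1 - G 1 ^ (2 * t - 1) / (G 1 ^ (2 * t - 1) + γ)) ^ k * G 1 := by
  have hp : 0 < G 1 ^ (2 * t - 1) := Real.rpow_pos_of_pos (hG 1 le_rfl) _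
  have hle : ∀ k, G (k + 1) ≤ G 1 := by
    intro k
    induction k with
    | zero => simp
    | succ n ih => exact (hdec (n + 1) (by omega)).trans ih
  have hq : 1 - G 1 ^ (2 * t - 1) / (G 1 ^ (2 * t - 1) + γ) = γ / (G 1 ^ (2 * t - 1) + γ) := by
    have : G 1 ^ (2 * t - 1) + γ ≠ 0 := by positivity
    field_simp
    ring
  rw [hq]
  induction k with
  | zero => simp
  | succ n ih =>
    have h1 := hr (n + 1) (by omega)
    have hpos := hG (n + 1 + 1) (by omega)
    have h2 : G 1 ^ (2 * t - 1) * G (n + 1 + 1) ≤ G (n + 1 + 1) ^ (2 * t) := by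
      have e : G (n + 1 + 1) ^ (2 * t) = G (n + 1 + 1) ^ (2 * t - 1) * G (n + 1 + 1) := by
        rw [Real.rpow_sub_one hpos.ne']; field_simp
      rw [e]
      exact mul_le_mul_of_nonneg_right
        (Real.rpow_le_rpow_of_nonpos hpos (hle (n + 1)) (by linarith)) hpos.le
    have h3 : G (n + 1 + 1) ≤ γ / (G 1 ^ (2 * t - 1) + γ) * G (n + 1) := by
      rw [div_mul_eq_mul_div, le_div_iff₀ (by positivity)]
      linarith
    refine h3.trans ?_
    rw [pow_succ', mul_assoc]
    exact mul_le_mul_of_nonneg_left ih (by positivity)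

/-- **Linear convergence of the cost gap under the KL inequality with
exponent `t ∈ (0, 1/2]` (Theorem 2, case 2).**  `ℂ^N` carries the Hermitian
inner product `⟨u,v⟩ = vᴴ u`; gradients are with respect to the real inner
product `Re(vᴴ u)`.  `h(x) = (1/2)‖Ax - y‖²`, `f` is `L`-smooth, `F = h + f ≥ F*`,
`η̲ I ⪯ B_k ⪯ η̄ I`, `0 < α < 2η̲/(η̲+L)`, each `x_{k+1}` is the global
minimizer of the `η̲`-strongly convex surrogate
`Φ_k(z) = h(z) + Re⟨∇f(x_k), z⟩ + (1/(2α))(z-x_k)ᴴB_k(z-x_k)`, and the KL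
bound `(F(x_{k+1}) - F*)^{2t} ≤ c²(1-t)²‖∇h(x_{k+1}) + ∇f(x_{k+1})‖²` holds
with `F(x_k) > F*`.  Then, with `υ = η̲/α - (η̲+L)/2`,
`γ = c²(1-t)²(Lα+η̄)²/(υα²)`, `F₁ = F(x₁) - F*`:
`F(x_{k+1}) - F* ≤ (1 - F₁^{2t-1}/(F₁^{2t-1} + γ))^k F₁`. -/
theorem gksm_linear_rate (m N : ℕ) (L : ℝ)
    (A : Matrix (Fin m) (Fin N) ℂ) (y : EuclideanSpace ℂ (Fin m))
    (h f : EuclideanSpace ℂ (Fin N) → ℝ)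
    (hhdef : ∀ x, h x = 1 / 2 * ‖Matrix.toEuclideanLin A x - y‖ ^ 2)
    (hfdiff : Differentiable ℝ f)
    (hflip : ∀ x₁ x₂ : EuclideanSpace ℂ (Fin N),
      ‖gradient f x₁ - gradient f x₂‖ ≤ L * ‖x₁ - x₂‖)
    (F : EuclideanSpace ℂ (Fin N) → ℝ) (hFdef : ∀ x, F x = h x + f x)
    (Fstar : ℝ) (hFlb : ∀ x, Fstar ≤ F x)
    (ηlo ηhi : ℝ) (hηlo : 0 < ηlo) (hηle : ηlo ≤ ηhi)
    (α : ℝ) (hα0 : 0 < α) (hαub : α < 2 * ηlo / (ηlo + L))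
    (B : ℕ → Matrix (Fin N) (Fin N) ℂ)
    (hBherm : ∀ k, (B k).IsHermitian)
    (hBlo : ∀ k, (B k - (ηlo : ℂ) • 1).PosSemidef)
    (hBhi : ∀ k, ((ηhi : ℂ) • 1 - B k).PosSemidef)
    (x : ℕ → EuclideanSpace ℂ (Fin N))
    (Φ : ℕ → EuclideanSpace ℂ (Fin N) → ℝ)
    (hΦdef : ∀ k z, Φ k z = h z + (inner (𝕜 := ℂ) (gradient f (x k)) z).re
      + 1 / (2 * α) * (inner (𝕜 := ℂ) (z - x k)
          (Matrix.toEuclideanLin (B k) (z - x k))).re)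
    (hstrong : ∀ k, 1 ≤ k → ConvexOn ℝ Set.univ (fun z => Φ k z - ηlo / 2 * ‖z‖ ^ 2))
    (hmin : ∀ k, 1 ≤ k → ∀ z, Φ k (x (k + 1)) ≤ Φ k z)
    (t c : ℝ) (ht : t ∈ Set.Ioc (0 : ℝ) (1 / 2)) (hc : 0 < c)
    (hKL : ∀ k, 1 ≤ k → (F (x (k + 1)) - Fstar) ^ (2 * t) ≤
      c ^ 2 * (1 - t) ^ 2 * ‖gradient h (x (k + 1)) + gradient f (x (k + 1))‖ ^ 2)
    (hgap : ∀ k, 1 ≤ k → Fstar < F (x k)) :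
    ∀ k : ℕ, 1 ≤ k →
      F (x (k + 1)) - Fstar ≤
        (1 - (F (x 1) - Fstar) ^ (2 * t - 1)
            / ((F (x 1) - Fstar) ^ (2 * t - 1)
              + c ^ 2 * (1 - t) ^ 2 * (L * α + ηhi) ^ 2
                / ((ηlo / α - (ηlo + L) / 2) * α ^ 2))) ^ k
          * (F (x 1) - Fstar) := by
  have hin : ∀ u v : EuclideanSpace ℂ (Fin N), (inner ℂ u v).re = inner ℝ u v := by
    intro u v
    simp [PiLp.inner_apply]
  let T : EuclideanSpace ℂ (Fin N) →L[ℝ] EuclideanSpace ℂ (Fin m) :=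
    ((Matrix.toEuclideanLin A).restrictScalars ℝ).toContinuousLinearMap
  let S : ℕ → EuclideanSpace ℂ (Fin N) →L[ℝ] EuclideanSpace ℂ (Fin N) := fun k =>
    ((Matrix.toEuclideanLin (B k)).restrictScalars ℝ).toContinuousLinearMap
  have hSa : ∀ k u, S k u = Matrix.toEuclideanLin (B k) u := fun k u => rfl
  have hS : ∀ k u v, inner ℝ (S k u) v = inner ℝ u (S k v) := by
    intro k u v
    rw [← hin, ← hin, hSa, hSa, (isSymmetric_toEuclideanLin_iff.mpr (hBherm k)) u v]
  have hnn : ∀ u : EuclideanSpace ℂ (Fin N), (inner ℂ u u).re = ‖u‖ ^ 2 := by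
    intro u
    rw [hin, real_inner_self_eq_norm_sq]
  have hlo : ∀ k u, ηlo * ‖u‖ ^ 2 ≤ inner ℝ u (S k u) := by
    intro k u
    have h1 := ((Matrix.isPositive_toEuclideanLin_iff.mpr (hBlo k))).re_inner_nonneg_right u
    have h2 : Matrix.toEuclideanLin (1 : Matrix (Fin N) (Fin N) ℂ) u = u := by
      simp
    rw [map_sub, map_smul, LinearMap.sub_apply, LinearMap.smul_apply, h2, inner_sub_right,
      inner_smul_right] at h1
    simp only [RCLike.re_to_complex, Complex.sub_re, Complex.re_ofReal_mul, hnn] at h1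
    rw [hin, ← hSa] at h1
    linarith
  have hhi : ∀ k u, inner ℝ u (S k u) ≤ ηhi * ‖u‖ ^ 2 := by
    intro k u
    have h1 := ((Matrix.isPositive_toEuclideanLin_iff.mpr (hBhi k))).re_inner_nonneg_right u
    have h2 : Matrix.toEuclideanLin (1 : Matrix (Fin N) (Fin N) ℂ) u = u := by
      simp
    rw [map_sub, map_smul, LinearMap.sub_apply, LinearMap.smul_apply, h2, inner_sub_right,
      inner_smul_right] at h1
    simp only [RCLike.re_to_complex, Complex.sub_re, Complex.re_ofReal_mul, hnn] at h1
    rw [hin, ← hSa] at h1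
    linarith
  have hηhi : 0 < ηhi := hηlo.trans_le hηle
  -- the trivial space makes the KL bound contradict the positive gap
  have hL : 0 ≤ L := by
    by_contra hneg
    have hsub : ∀ u : EuclideanSpace ℂ (Fin N), u = 0 := by
      intro u
      by_contra hu
      have h1 := hflip u 0
      have h2 : 0 < ‖u - 0‖ := by simpa using hu
      nlinarith [norm_nonneg (gradient f u - gradient f 0)]
    have h1 := hKL 1 le_rfl
    rw [hsub (gradient h _ + _), norm_zero] at h1
    have h2 := Real.rpow_pos_of_pos (sub_pos.2 (hgap 2 (by norm_num))) (2 * t)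
    norm_num at h1
    linarith
  set υ := ηlo / α - (ηlo + L) / 2 with hυ
  have hυ0 : 0 < υ := by
    rw [lt_div_iff₀ (by linarith)] at hαub
    rw [hυ, sub_pos, lt_div_iff₀ hα0]
    linarith
  have hstep : ∀ k, 1 ≤ k → υ * ‖x (k + 1) - x k‖ ^ 2 ≤ F (x k) - F (x (k + 1)) ∧
      ‖gradient h (x (k + 1)) + gradient f (x (k + 1))‖ ≤
        (L * α + ηhi) / α * ‖x (k + 1) - x k‖ := by
    intro k hk
    obtain ⟨h1, h2⟩ := step_aux T (S k) (hS k) y h hhdef (gradient f (x k)) (x k) (x (k + 1))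
      (1 / α) (by
        intro z
        have := hmin k hk z
        rw [hΦdef, hΦdef] at this
        simp only [hin, ← hSa] at this
        have e : 1 / (2 * α) = 1 / α / 2 := by field_simp
        rw [e] at this
        exact this)
    have hd := descent_aux f L hfdiff hflip (x k) (x (k + 1) - x k)
    rw [add_sub_cancel] at hd
    have h3 := hlo k (x (k + 1) - x k)
    constructor
    · have h4 : ηlo / α * ‖x (k + 1) - x k‖ ^ 2 ≤
          1 / α * inner ℝ (x (k + 1) - x k) (S k (x (k + 1) - x k)) := by
        calc _ = 1 / α * (ηlo * ‖x (k + 1) - x k‖ ^ 2) := by ring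
          _ ≤ _ := mul_le_mul_of_nonneg_left h3 (by positivity)
      rw [inner_sub_right] at hd
      rw [hFdef, hFdef, hυ]
      nlinarith [sq_nonneg ‖T (x (k + 1) - x k)‖, mul_nonneg hηlo.le (sq_nonneg ‖x (k + 1) - x k‖)]
    · have h5 := norm_aux (S k) (hS k) ηhi hηhi
        (fun u => le_trans (by positivity) (hlo k u)) (hhi k) (x (k + 1) - x k)
      have e : gradient h (x (k + 1)) + gradient f (x (k + 1)) =
          (gradient f (x (k + 1)) - gradient f (x k)) - (1 / α) • S k (x (k + 1) - x k) := by
        rw [h1]; abel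
      rw [e]
      refine (norm_sub_le _ _).trans ?_
      rw [norm_smul, Real.norm_of_nonneg (by positivity)]
      have h6 := hflip (x (k + 1)) (x k)
      have h7 := mul_le_mul_of_nonneg_left h5 (show 0 ≤ 1 / α by positivity)
      have e2 : (L * α + ηhi) / α * ‖x (k + 1) - x k‖ =
          L * ‖x (k + 1) - x k‖ + 1 / α * (ηhi * ‖x (k + 1) - x k‖) := by
        field_simp
      rw [e2]
      linarith
  intro k _
  refine rec_aux (fun k => F (x k) - Fstar)
    (c ^ 2 * (1 - t) ^ 2 * (L * α + ηhi) ^ 2 / (υ * α ^ 2)) t (by positivity) ht.2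
    (fun k hk => sub_pos.2 (hgap k hk)) ?_ ?_ k
  · intro k hk
    have h1 := (hstep k hk).1
    have h2 : 0 ≤ υ * ‖x (k + 1) - x k‖ ^ 2 := by positivity
    show F (x (k + 1)) - Fstar ≤ F (x k) - Fstar
    linarith
  · intro k hk
    obtain ⟨h1, h2⟩ := hstep k hk
    refine (hKL k hk).trans ?_
    show _ ≤ _ * (F (x k) - Fstar - (F (x (k + 1)) - Fstar))
    rw [sub_sub_sub_cancel_right]
    calc _ ≤ c ^ 2 * (1 - t) ^ 2 * ((L * α + ηhi) / α * ‖x (k + 1) - x k‖) ^ 2 := by gcongr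
      _ = c ^ 2 * (1 - t) ^ 2 * (L * α + ηhi) ^ 2 / (υ * α ^ 2) *
          (υ * ‖x (k + 1) - x k‖ ^ 2) := by
        field_simp
      _ ≤ _ := by gcongr
end

section
/- Let A ∈ ℂ^{m×N}, y ∈ ℂ^m, h(x) = (1/2)‖Ax − y‖², and let f : ℂ^N → ℝ be L-smooth with F = h + f and F* ∈ ℝ satisfying F(x) ≥ F* for all x. Fix 0 < η̲ ≤ η̄ < ∞ and 0 < α < 2η̲/(η̲ + L), and let (B_k)_{k≥1} be Hermitian matrices with η̲ I_N ⪯ B_k ⪯ η̄ I_N. Let (x_k)_{k≥1} ⊂ ℂ^N be such that for each k, the function Φ_k(x) = h(x) + Re⟨∇f(x_k), x⟩ + (1/(2α))(x − x_k)^H B_k (x − x_k) is η̲-strongly convex and x_{k+1} is its global minimizer over ℂ^N. Fix t ∈ (1/2, 1) and c > 0, and assume the Kurdyka–Łojasiewicz bound (F(x_{k+1}) − F*)^{2t} ≤ c²(1−t)² ‖∇h(x_{k+1}) + ∇f(x_{k+1})‖² holds for all k ≥ 1, and that F(x_k) > F* for all k ≥ 1. Then, with υ = η̲/α − (η̲+L)/2,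 γ = c²(1−t)²(Lα + η̄)²/(υ α²), and F₁ = F(x₁) − F*, one has for every σ ∈ (0,1) and all k ≥ 1: F(x_{k+1}) − F* ≤ max( (1−σ)^{k/2} F₁ , ( F₁^{1−2t} + (2t−1)(1−σ)^{2t} k/(2γ) )^{1/(1−2t)} ). -/
open Matrix
open scoped ComplexOrder

lemma aux_descent {E : Type*} [NormedAddCommGroup E] [InnerProductSpace ℝ E] [CompleteSpace E]
    (f : E → ℝ) (L : ℝ) (hf : Differentiable ℝ f)
    (hl : ∀ a b : E, ‖gradient f a - gradient f b‖ ≤ L * ‖a - b‖) (x d : E) :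
    f (x + d) ≤ f x + inner ℝ (gradient f x) d + L / 2 * ‖d‖ ^ 2 := by
  let φ : ℝ → ℝ := fun s => f (x + s • d) - s * inner ℝ (gradient f x) d - L / 2 * s ^ 2 * ‖d‖ ^ 2
  have hd : ∀ s : ℝ, HasDerivAt φ (inner ℝ (gradient f (x + s • d)) d
      - inner ℝ (gradient f x) d - L * s * ‖d‖ ^ 2) s := by
    intro s
    have h1 : HasDerivAt (fun s : ℝ => x + s • d) d s := by
      simpa using ((hasDerivAt_id s).smul_const d).const_add x
    have h2 := (hf (x + s • d)).hasGradientAt.hasFDerivAt.comp_hasDerivAt s h1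
    have h3 : HasDerivAt (fun s : ℝ => s * inner ℝ (gradient f x) d)
        (inner ℝ (gradient f x) d) s := by
      simpa using (hasDerivAt_id s).mul_const (inner ℝ (gradient f x) d)
    have h4 : HasDerivAt (fun s : ℝ => L / 2 * s ^ 2 * ‖d‖ ^ 2) (L * s * ‖d‖ ^ 2) s := by
      have := ((hasDerivAt_pow 2 s).const_mul (L / 2)).mul_const (‖d‖ ^ 2)
      exact this.congr_deriv (by norm_num; left; ring)
    exact ((h2.sub h3).sub h4).congr_deriv (by simp)
  have hanti : AntitoneOn φ (Set.Icc 0 1) := by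
    apply antitoneOn_of_deriv_nonpos (convex_Icc 0 1)
    · exact fun s _ => (hd s).continuousAt.continuousWithinAt
    · exact fun s _ => (hd s).differentiableAt.differentiableWithinAt
    · intro s hs
      rw [interior_Icc] at hs
      rw [(hd s).deriv, ← inner_sub_left]
      have h1 := real_inner_le_norm (gradient f (x + s • d) - gradient f x) d
      have h2 := hl (x + s • d) x
      rw [add_sub_cancel_left, norm_smul, Real.norm_of_nonneg hs.1.le] at h2
      nlinarith [mul_le_mul_of_nonneg_right h2 (norm_nonneg d)]
  have := hanti (Set.left_mem_Icc.2 zero_le_one) (Set.right_mem_Icc.2 zero_le_one) zero_le_one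
  simp only [φ, one_smul, zero_smul, add_zero] at this
  linarith

lemma aux_quad {E : Type*} [NormedAddCommGroup E] [InnerProductSpace ℝ E] [CompleteSpace E]
    (f : E → ℝ) (w z : E) (C : ℝ)
    (hq : ∀ v, |f (z + v) - f z - inner ℝ w v| ≤ C * ‖v‖ ^ 2) : HasGradientAt f w z := by
  rw [hasGradientAt_iff_hasFDerivAt, hasFDerivAt_iff_isLittleO_nhds_zero]
  have h1 : (fun v : E => f (z + v) - f z - (InnerProductSpace.toDual ℝ E) w v)
      =O[nhds 0] (fun v : E => ‖v‖ ^ 2) := by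
    apply Asymptotics.IsBigO.of_bound C
    filter_upwards with v
    simpa using hq v
  refine h1.trans_isLittleO ?_
  exact Asymptotics.isLittleO_norm_pow_id one_lt_two

lemma aux_step {E E' : Type*} [NormedAddCommGroup E] [InnerProductSpace ℝ E] [CompleteSpace E]
    [NormedAddCommGroup E'] [InnerProductSpace ℝ E'] [CompleteSpace E']
    (A : E →L[ℝ] E') (y : E') (h f : E → ℝ)
    (hh : ∀ x, h x = 1 / 2 * ‖A x - y‖ ^ 2) (L : ℝ) (hf : Differentiable ℝ f)
    (hl : ∀ a b : E, ‖gradient f a - gradient f b‖ ≤ L * ‖a - b‖)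
    (ηlo ηhi α : ℝ) (hlo0 : 0 < ηlo) (hle : ηlo ≤ ηhi) (hα : 0 < α)
    (B : E →L[ℝ] E) (hsym : ∀ u v, inner ℝ (B u) v = inner ℝ u (B v))
    (hBlo : ∀ v, ηlo * ‖v‖ ^ 2 ≤ inner ℝ v (B v))
    (hBhi : ∀ v, inner ℝ v (B v) ≤ ηhi * ‖v‖ ^ 2)
    (x p : E)
    (hmin : ∀ z, h p + inner ℝ (gradient f x) p + 1 / (2 * α) * inner ℝ (p - x) (B (p - x))
       ≤ h z + inner ℝ (gradient f x) z + 1 / (2 * α) * inner ℝ (z - x) (B (z - x))) :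
    (ηlo / α - (ηlo + L) / 2) * ‖p - x‖ ^ 2 ≤ (h x + f x) - (h p + f p) ∧
    ‖gradient h p + gradient f p‖ ≤ (L * α + ηhi) / α * ‖p - x‖ := by
  have hexp : ∀ z v, h (z + v) = h z + inner ℝ (A.adjoint (A z - y)) v + 1 / 2 * ‖A v‖ ^ 2 := by
    intro z v
    rw [hh, hh, ContinuousLinearMap.adjoint_inner_left, map_add,
      show A z + A v - y = (A z - y) + A v by abel, norm_add_sq_real]
    ring
  have hgh : ∀ z, HasGradientAt h (A.adjoint (A z - y)) z := by
    intro z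
    apply aux_quad _ _ _ (1 / 2 * ‖A‖ ^ 2)
    intro v
    rw [hexp]
    have h1 := A.le_opNorm v
    have h2 : ‖A v‖ ^ 2 ≤ (‖A‖ * ‖v‖) ^ 2 := by gcongr
    rw [abs_of_nonneg (by ring_nf; positivity)]
    nlinarith
  set g := gradient f x with hg
  set d := p - x with hd
  set w := A.adjoint (A p - y) + g + (1 / α) • B d with hw
  have hstat : w = 0 := by
    have key : HasGradientAt (fun z => h z + inner ℝ g z + 1 / (2 * α) * inner ℝ (z - x) (B (z - x)))
        w p := by
      apply aux_quad _ _ _ (1 / 2 * ‖A‖ ^ 2 + 1 / (2 * α) * ηhi)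
      intro v
      have e : h (p + v) + inner ℝ g (p + v) + 1 / (2 * α) * inner ℝ (p + v - x) (B (p + v - x))
        - (h p + inner ℝ g p + 1 / (2 * α) * inner ℝ (p - x) (B (p - x))) - inner ℝ w v
        = 1 / 2 * ‖A v‖ ^ 2 + 1 / (2 * α) * inner ℝ v (B v) := by
        rw [hexp, show p + v - x = d + v by rw [hd]; abel, ← hd, hw]
        simp only [map_add, inner_add_left, inner_add_right, inner_smul_left]
        rw [← hsym d v, real_inner_comm (B d) v]
        simp
        field_simp
        ring
      rw [e]
      have h1 := A.le_opNorm v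
      have h2 : ‖A v‖ ^ 2 ≤ (‖A‖ * ‖v‖) ^ 2 := by gcongr
      have h3 : 0 ≤ inner ℝ v (B v) := le_trans (by positivity) (hBlo v)
      have h4 := mul_le_mul_of_nonneg_left (hBhi v) (show 0 ≤ 1 / (2 * α) by positivity)
      rw [abs_of_nonneg (by positivity)]
      nlinarith
    have hm : IsLocalMin (fun z => h z + inner ℝ g z + 1 / (2 * α) * inner ℝ (z - x) (B (z - x))) p :=
      Filter.Eventually.of_forall hmin
    have := hm.hasFDerivAt_eq_zero key.hasFDerivAt
    simpa using this
  have hGe : A.adjoint (A p - y) = - g - (1 / α) • B d := by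
    rw [hw] at hstat
    rw [← sub_eq_zero, ← hstat]; abel
  constructor
  · have h1 := hexp p (-d)
    rw [show p + -d = x by rw [hd]; abel, hGe] at h1
    have h2 := aux_descent f L hf hl x d
    rw [show x + d = p by rw [hd]; abel, ← hg] at h2
    simp only [inner_neg_right, inner_sub_left, inner_neg_left, inner_smul_left] at h1
    simp at h1
    have h3 := hBlo d
    rw [← hsym] at h3
    have h4 := mul_le_mul_of_nonneg_left h3 (show 0 ≤ α⁻¹ by positivity)
    have h5 : ηlo / α = α⁻¹ * ηlo := by ring
    rw [h5]
    nlinarith [sq_nonneg ‖A d‖, mul_nonneg hlo0.le (sq_nonneg ‖d‖)]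
  · rw [(hgh p).gradient, hGe]
    have hhi0 : 0 < ηhi := lt_of_lt_of_le hlo0 hle
    have hBn : ‖B d‖ ≤ ηhi * ‖d‖ := by
      have h1 : 0 ≤ inner ℝ (d - (1 / ηhi) • B d) (B (d - (1 / ηhi) • B d)) :=
        le_trans (by positivity) (hBlo _)
      have h2 := hBhi (B d)
      have h3 := hBhi d
      simp only [map_sub, map_smul, inner_sub_left, inner_sub_right, inner_smul_left,
        inner_smul_right] at h1
      rw [← hsym d (B d), real_inner_self_eq_norm_sq] at h1
      simp at h1
      have h4 : ηhi⁻¹ * (ηhi⁻¹ * inner ℝ (B d) (B (B d))) ≤ ηhi⁻¹ * ‖B d‖ ^ 2 := by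
        gcongr
        rw [inv_mul_le_iff₀ hhi0]; exact h2
      have h5 : ηhi⁻¹ * ‖B d‖ ^ 2 ≤ ηhi * ‖d‖ ^ 2 := by nlinarith
      rw [inv_mul_le_iff₀ hhi0] at h5
      apply le_of_sq_le_sq _ (by positivity)
      nlinarith
    have h6 : -g - (1 / α) • B d + gradient f p = (gradient f p - g) - (1 / α) • B d := by abel
    rw [h6]
    refine (norm_sub_le _ _).trans ?_
    rw [norm_smul, Real.norm_of_nonneg (by positivity)]
    have h7 := hl p x
    have h8 : (1 / α) * ‖B d‖ ≤ (1 / α) * (ηhi * ‖d‖) := by gcongr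
    calc _ ≤ L * ‖d‖ + (1 / α) * (ηhi * ‖d‖) := add_le_add h7 h8
      _ = _ := by field_simp

lemma aux_seq (r : ℕ → ℝ) (γ t σ : ℝ) (hγ : 0 < γ) (ht : 1 / 2 < t) (hσ0 : 0 < σ) (hσ1 : σ < 1)
    (hr : ∀ k, 1 ≤ k → 0 < r k)
    (hstep : ∀ k, 1 ≤ k → r (k + 1) ^ (2 * t) ≤ γ * (r k - r (k + 1))) (k : ℕ) :
    ∃ a b : ℕ, a + b = k ∧ r (k + 1) ≤ (1 - σ) ^ a * r 1 ∧
      r 1 ^ (1 - 2 * t) + b * ((2 * t - 1) * (1 - σ) ^ (2 * t) / γ) ≤ r (k + 1) ^ (1 - 2 * t) := by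
  induction k with
  | zero => exact ⟨0, 0, by simp⟩
  | succ k ih =>
    obtain ⟨a, b, hab, h1, h2⟩ := ih
    have hu := hr (k + 1) (by omega)
    have hv := hr (k + 1 + 1) (by omega)
    have hs := hstep (k + 1) (by omega)
    set u := r (k + 1)
    set v := r (k + 1 + 1)
    have hvu : v ≤ u := by
      have : 0 < v ^ (2 * t) := Real.rpow_pos_of_pos hv _
      have : 0 < u - v := by
        by_contra hcon
        nlinarith
      linarith
    by_cases hc : v ≤ (1 - σ) * u
    · refine ⟨a + 1, b, by omega, ?_, h2.trans ?_⟩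
      · rw [pow_succ']
        have := mul_le_mul_of_nonneg_left h1 (show 0 ≤ 1 - σ by linarith)
        linarith
      · exact Real.rpow_le_rpow_of_nonpos hv hvu (by linarith)
    · push Not at hc
      refine ⟨a, b + 1, by omega, hvu.trans h1, ?_⟩
      have h3 : ((1 - σ) * u) ^ (2 * t) ≤ v ^ (2 * t) :=
        Real.rpow_le_rpow (mul_nonneg (by linarith) hu.le) hc.le (by linarith)
      rw [Real.mul_rpow (by linarith) hu.le] at h3
      -- tangent inequality
      have hb : 1 + (1 - 2 * t) * (v / u - 1) ≤ (1 + (v / u - 1)) ^ (1 - 2 * t) := by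
        have hq : 0 < v / u := div_pos hv hu
        rw [add_sub_cancel, Real.rpow_def_of_pos hq]
        have e1 := Real.add_one_le_exp (Real.log (v / u) * (1 - 2 * t))
        have e2 := Real.log_le_sub_one_of_pos hq
        nlinarith
      have h4 : (1 + (v / u - 1)) ^ (1 - 2 * t) = v ^ (1 - 2 * t) / u ^ (1 - 2 * t) := by
        rw [add_sub_cancel, Real.div_rpow hv.le hu.le]
      have hup : 0 < u ^ (1 - 2 * t) := Real.rpow_pos_of_pos hu _
      rw [h4, le_div_iff₀ hup] at hb
      have h5 : u ^ (1 - 2 * t) = u / u ^ (2 * t) := by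
        rw [Real.rpow_sub hu, Real.rpow_one]
      have hU : 0 < u ^ (2 * t) := Real.rpow_pos_of_pos hu _
      have h6 : (1 - σ) ^ (2 * t) / γ ≤ (u - v) / u ^ (2 * t) := by
        rw [div_le_div_iff₀ hγ hU]; linarith
      have h7 : (1 + (1 - 2 * t) * (v / u - 1)) * u ^ (1 - 2 * t)
          = u ^ (1 - 2 * t) + (2 * t - 1) * ((u - v) / u ^ (2 * t)) := by
        rw [h5]; field_simp; ring
      rw [h7] at hb
      have h8 := mul_le_mul_of_nonneg_left h6 (show 0 ≤ 2 * t - 1 by linarith)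
      rw [← mul_div_assoc] at h8
      push_cast
      linarith

lemma aux_rate (r : ℕ → ℝ) (γ t σ : ℝ) (hγ : 0 < γ) (ht : 1 / 2 < t) (hσ0 : 0 < σ) (hσ1 : σ < 1)
    (hr : ∀ k, 1 ≤ k → 0 < r k)
    (hstep : ∀ k, 1 ≤ k → r (k + 1) ^ (2 * t) ≤ γ * (r k - r (k + 1))) (k : ℕ) :
    r (k + 1) ≤ max ((1 - σ) ^ ((k : ℝ) / 2) * r 1)
      ((r 1 ^ (1 - 2 * t) + (2 * t - 1) * (1 - σ) ^ (2 * t) * (k : ℝ) / (2 * γ))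
        ^ (1 / (1 - 2 * t))) := by
  obtain ⟨a, b, hab, h1, h2⟩ := aux_seq r γ t σ hγ ht hσ0 hσ1 hr hstep k
  have hr1 := hr 1 le_rfl
  have hv := hr (k + 1) (by omega)
  have hk : (a : ℝ) + b = k := by exact_mod_cast hab
  rcases le_total ((k : ℝ) / 2) a with hc | hc
  · apply le_max_of_le_left
    refine h1.trans ?_
    rw [← Real.rpow_natCast]
    apply mul_le_mul_of_nonneg_right _ hr1.le
    exact Real.rpow_le_rpow_of_exponent_ge (by linarith) (by linarith) hc
  · apply le_max_of_le_right
    have hδ : 0 < (2 * t - 1) * (1 - σ) ^ (2 * t) / γ := by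
      have := Real.rpow_pos_of_pos (show 0 < 1 - σ by linarith) (2 * t)
      have : 0 < 2 * t - 1 := by linarith
      positivity
    have hp := Real.rpow_pos_of_pos hr1 (1 - 2 * t)
    have e : (2 * t - 1) * (1 - σ) ^ (2 * t) * (k : ℝ) / (2 * γ)
      = (k / 2) * ((2 * t - 1) * (1 - σ) ^ (2 * t) / γ) := by field_simp
    rw [e]
    have h3 : r 1 ^ (1 - 2 * t) + (k / 2) * ((2 * t - 1) * (1 - σ) ^ (2 * t) / γ)
        ≤ r (k + 1) ^ (1 - 2 * t) := by
      refine le_trans ?_ h2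
      gcongr
      linarith
    have h4 : 0 < r 1 ^ (1 - 2 * t) + (k / 2) * ((2 * t - 1) * (1 - σ) ^ (2 * t) / γ) := by
      positivity
    have h5 := Real.rpow_le_rpow_of_nonpos h4 h3
      (show 1 / (1 - 2 * t) ≤ 0 from div_nonpos_of_nonneg_of_nonpos zero_le_one (by linarith))
    rwa [← Real.rpow_mul hv.le, mul_one_div_cancel (by linarith), Real.rpow_one] at h5

lemma aux_inner {n : ℕ} (u v : EuclideanSpace ℂ (Fin n)) :
    inner ℝ u v = (inner ℂ u v).re := by
  simp [PiLp.inner_apply]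

lemma aux_psd {n : ℕ} (M : Matrix (Fin n) (Fin n) ℂ) (hM : M.PosSemidef)
    (v : EuclideanSpace ℂ (Fin n)) : 0 ≤ (inner ℂ v (Matrix.toEuclideanLin M v)).re := by
  have := (Matrix.isPositive_toEuclideanLin_iff.2 hM).re_inner_nonneg_right v
  simpa using this

/-- **Sublinear convergence of the cost gap under the KL inequality with
exponent `t ∈ (1/2, 1)` (Theorem 2, case 3).**  Setting as in the linear-rate
case: `h(x) = (1/2)‖Ax - y‖²`, `f` is `L`-smooth, `F = h + f ≥ F*`,
`η̲ I ⪯ B_k ⪯ η̄ I`, `0 < α < 2η̲/(η̲+L)`, each `x_{k+1}` globally minimizes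
the `η̲`-strongly convex surrogate `Φ_k`, and the KL bound holds with
`F(x_k) > F*`.  Then, with `υ = η̲/α - (η̲+L)/2`,
`γ = c²(1-t)²(Lα+η̄)²/(υα²)`, `F₁ = F(x₁) - F*`, for every `σ ∈ (0,1)`:
`F(x_{k+1}) - F* ≤ max((1-σ)^{k/2}F₁, (F₁^{1-2t} + (2t-1)(1-σ)^{2t}k/(2γ))^{1/(1-2t)})`. -/
theorem gksm_sublinear_rate (m N : ℕ) (L : ℝ)
    (A : Matrix (Fin m) (Fin N) ℂ) (y : EuclideanSpace ℂ (Fin m))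
    (h f : EuclideanSpace ℂ (Fin N) → ℝ)
    (hhdef : ∀ x, h x = 1 / 2 * ‖Matrix.toEuclideanLin A x - y‖ ^ 2)
    (hfdiff : Differentiable ℝ f)
    (hflip : ∀ x₁ x₂ : EuclideanSpace ℂ (Fin N),
      ‖gradient f x₁ - gradient f x₂‖ ≤ L * ‖x₁ - x₂‖)
    (F : EuclideanSpace ℂ (Fin N) → ℝ) (hFdef : ∀ x, F x = h x + f x)
    (Fstar : ℝ) (hFlb : ∀ x, Fstar ≤ F x)
    (ηlo ηhi : ℝ) (hηlo : 0 < ηlo) (hηle : ηlo ≤ ηhi)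
    (α : ℝ) (hα0 : 0 < α) (hαub : α < 2 * ηlo / (ηlo + L))
    (B : ℕ → Matrix (Fin N) (Fin N) ℂ)
    (hBherm : ∀ k, (B k).IsHermitian)
    (hBlo : ∀ k, (B k - (ηlo : ℂ) • 1).PosSemidef)
    (hBhi : ∀ k, ((ηhi : ℂ) • 1 - B k).PosSemidef)
    (x : ℕ → EuclideanSpace ℂ (Fin N))
    (Φ : ℕ → EuclideanSpace ℂ (Fin N) → ℝ)
    (hΦdef : ∀ k z, Φ k z = h z + (inner (𝕜 := ℂ) (gradient f (x k)) z).re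
      + 1 / (2 * α) * (inner (𝕜 := ℂ) (z - x k)
          (Matrix.toEuclideanLin (B k) (z - x k))).re)
    (hstrong : ∀ k, 1 ≤ k → ConvexOn ℝ Set.univ (fun z => Φ k z - ηlo / 2 * ‖z‖ ^ 2))
    (hmin : ∀ k, 1 ≤ k → ∀ z, Φ k (x (k + 1)) ≤ Φ k z)
    (t c : ℝ) (ht : t ∈ Set.Ioo (1 / 2 : ℝ) 1) (hc : 0 < c)
    (hKL : ∀ k, 1 ≤ k → (F (x (k + 1)) - Fstar) ^ (2 * t) ≤
      c ^ 2 * (1 - t) ^ 2 * ‖gradient h (x (k + 1)) + gradient f (x (k + 1))‖ ^ 2)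
    (hgap : ∀ k, 1 ≤ k → Fstar < F (x k)) :
    ∀ σ ∈ Set.Ioo (0 : ℝ) 1, ∀ k : ℕ, 1 ≤ k →
      F (x (k + 1)) - Fstar ≤
        max ((1 - σ) ^ ((k : ℝ) / 2) * (F (x 1) - Fstar))
          (((F (x 1) - Fstar) ^ (1 - 2 * t)
            + (2 * t - 1) * (1 - σ) ^ (2 * t) * (k : ℝ)
              / (2 * (c ^ 2 * (1 - t) ^ 2 * (L * α + ηhi) ^ 2
                  / ((ηlo / α - (ηlo + L) / 2) * α ^ 2)))) ^ (1 / (1 - 2 * t))) := by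
  intro σ hσ k hk
  obtain ⟨ht1, ht2⟩ := ht
  have hsum : 0 < ηlo + L := by
    by_contra hcon
    have := div_nonpos_of_nonneg_of_nonpos (show 0 ≤ 2 * ηlo by linarith) (not_lt.1 hcon)
    linarith
  have hυ : 0 < ηlo / α - (ηlo + L) / 2 := by
    rw [lt_div_iff₀ hsum] at hαub
    rw [sub_pos, lt_div_iff₀ hα0]
    linarith
  have hst : ∀ k, 1 ≤ k →
      (ηlo / α - (ηlo + L) / 2) * ‖x (k + 1) - x k‖ ^ 2 ≤ F (x k) - F (x (k + 1)) ∧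
      ‖gradient h (x (k + 1)) + gradient f (x (k + 1))‖
        ≤ (L * α + ηhi) / α * ‖x (k + 1) - x k‖ := by
    intro k hk
    rw [hFdef, hFdef]
    refine aux_step
      (((Matrix.toEuclideanLin A).toContinuousLinearMap).restrictScalars ℝ) y h f ?_ L hfdiff
      hflip ηlo ηhi α hηlo hηle hα0
      (((Matrix.toEuclideanLin (B k)).toContinuousLinearMap).restrictScalars ℝ)
      ?_ ?_ ?_ (x k) (x (k + 1)) ?_
    · intro z; simpa using hhdef z
    · intro u v
      rw [aux_inner, aux_inner]
      have := (Matrix.isSymmetric_toEuclideanLin_iff.2 (hBherm k)) u v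
      exact congrArg Complex.re this
    · intro v
      rw [aux_inner]
      have := aux_psd _ (hBlo k) v
      simp only [map_sub, map_smul, LinearMap.sub_apply, LinearMap.smul_apply, inner_sub_right,
        inner_smul_right, Matrix.toLpLin_one, LinearMap.id_apply, inner_self_eq_norm_sq_to_K] at this
      simp [← Complex.ofReal_pow] at this
      simpa using this
    · intro v
      rw [aux_inner]
      have := aux_psd _ (hBhi k) v
      simp only [map_sub, map_smul, LinearMap.sub_apply, LinearMap.smul_apply, inner_sub_right,
        inner_smul_right, Matrix.toLpLin_one, LinearMap.id_apply, inner_self_eq_norm_sq_to_K] at this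
      simp [← Complex.ofReal_pow] at this
      simpa using this
    · intro z
      have := hmin k hk z
      rw [hΦdef, hΦdef] at this
      simp only [aux_inner]
      exact this
  set κ := (L * α + ηhi) / α with hκ
  set υ := ηlo / α - (ηlo + L) / 2 with hυd
  have hcc : 0 < c ^ 2 * (1 - t) ^ 2 := by
    have : 0 < 1 - t := by linarith
    positivity
  have hκ0 : L * α + ηhi ≠ 0 := by
    intro h0
    have h1 := (hst 1 le_rfl).2
    rw [hκ, h0, zero_div, zero_mul] at h1
    have h2 := hKL 1 le_rfl
    rw [le_antisymm h1 (norm_nonneg _)] at h2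
    have h3 := Real.rpow_pos_of_pos (sub_pos.2 (hgap (1 + 1) (by omega))) (2 * t)
    simp at h2
    linarith
  refine aux_rate (fun k => F (x k) - Fstar) _ t σ ?_ ht1 hσ.1 hσ.2
    (fun k hk => sub_pos.2 (hgap k hk)) ?_ k
  · positivity
  · intro k hk
    obtain ⟨h1, h2⟩ := hst k hk
    have h3 : ‖gradient h (x (k + 1)) + gradient f (x (k + 1))‖ ^ 2
        ≤ (κ * ‖x (k + 1) - x k‖) ^ 2 := by gcongr
    calc (F (x (k + 1)) - Fstar) ^ (2 * t)
        ≤ c ^ 2 * (1 - t) ^ 2 * (κ * ‖x (k + 1) - x k‖) ^ 2 :=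
          (hKL k hk).trans (mul_le_mul_of_nonneg_left h3 hcc.le)
      _ = c ^ 2 * (1 - t) ^ 2 * (L * α + ηhi) ^ 2 / (υ * α ^ 2)
          * (υ * ‖x (k + 1) - x k‖ ^ 2) := by rw [hκ]; field_simp
      _ ≤ _ := by
        apply mul_le_mul_of_nonneg_left _ (by positivity)
        linarith
end
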